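/- For n ≥ m ≥ 1, the total number of occurrences of the subword pattern 1^m (m equal consecutive letters) over all non-crossing partitions of [n] equals binom(2r, r+1), where r = n − m + 1. -/

import Mathlib

/-- `l` is a restricted growth sequence (canonical sequential form of a set
partition): it starts with 1, all letters are ≥ 1, and each letter is at most
one more than the maximum of the preceding prefix. -/
def IsRGS (l : List ℕ) : Prop :=
  l.getD 0 1 = 1 ∧ (∀ x ∈ l, 1 ≤ x) ∧
  ∀ i, i + 1 < l.length → l.getD (i + 1) 0 ≤ (l.take (i + 1)).foldr max 0 + 1

/-- `l` contains a (classical) occurrence of 1-2-1-2: a subsequence a,b,a,b with a < b. -/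
def Crossing (l : List ℕ) : Prop :=
  ∃ i j k m : ℕ, i < j ∧ j < k ∧ k < m ∧ m < l.length ∧
    l.getD i 0 = l.getD k 0 ∧ l.getD j 0 = l.getD m 0 ∧ l.getD i 0 < l.getD j 0

/-- `l` is the canonical sequential form of a non-crossing partition of [n]. -/
def NCseq (n : ℕ) (l : List ℕ) : Prop := l.length = n ∧ IsRGS l ∧ ¬ Crossing l

/-- Two lists of the same length are order-isomorphic. -/
def OrdIso (s t : List ℕ) : Prop :=
  s.length = t.length ∧ ∀ j k, j < s.length → k < s.length →
    (s.getD j 0 < s.getD k 0 ↔ t.getD j 0 < t.getD k 0)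

/-- The subword pattern `τ` occurs in `l` starting at position `i`. -/
def occAt (τ l : List ℕ) (i : ℕ) : Prop := OrdIso τ ((l.drop i).take τ.length)

/-- The number of occurrences of the subword pattern `τ` in `l`. -/
noncomputable def occCount (τ l : List ℕ) : ℕ := Nat.card {i : ℕ // occAt τ l i}

/-- The total number of occurrences of the subword pattern `τ` over all
members of NC_n, counted with multiplicity (as marked occurrences). -/
noncomputable def totalOcc (n : ℕ) (τ : List ℕ) : ℕ :=
  Nat.card {p : List ℕ × ℕ // NCseq n p.1 ∧ occAt τ p.1 p.2}

open Finset

/-- `Admissible M S w`: the word `w` extends a canonical form of a non-crossing partition with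
largest letter `M` whose set of possible next letters is `S`. -/
def Admissible : ℕ → Finset ℕ → List ℕ → Prop
  | _, _, [] => True
  | M, S, x :: w => x ∈ S ∧ Admissible (max M x) (insert (max M x + 1) {y ∈ S | y ≤ x}) w

/-- The admissible words of length `n`. -/
def admissibleWords : ℕ → ℕ → Finset ℕ → Finset (List ℕ)
  | 0, _, _ => {[]}
  | n + 1, M, S => S.biUnion fun x =>
      (admissibleWords n (max M x) (insert (max M x + 1) {y ∈ S | y ≤ x})).image (List.cons x)

/-- The letters that may follow the canonical form `l`. -/
def nextLetters (l : List ℕ) : Finset ℕ :=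
  {y ∈ Icc 1 (l.foldr max 0 + 1) | l.Pairwise fun a b => a = y → y ≤ b}

theorem foldr_max_append_singleton (l : List ℕ) (x : ℕ) :
    (l ++ [x]).foldr max 0 = max (l.foldr max 0) x := by
  induction l with
  | nil => simp
  | cons a l ih => simp only [List.cons_append, List.foldr_cons, ih, max_assoc]

theorem le_foldr_max {l : List ℕ} {x : ℕ} (h : x ∈ l) : x ≤ l.foldr max 0 := by
  induction l with
  | nil => simp at h
  | cons a l ih =>
    simp only [List.foldr_cons]
    rcases List.mem_cons.1 h with rfl | h
    · exact le_max_left _ _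
    · exact (ih h).trans (le_max_right _ _)

theorem isRGS_append_singleton (l : List ℕ) (x : ℕ) :
    IsRGS (l ++ [x]) ↔ IsRGS l ∧ 1 ≤ x ∧ x ≤ l.foldr max 0 + 1 := by
  rcases l.eq_nil_or_concat with rfl | ⟨l', z, rfl⟩
  · simp only [IsRGS, List.nil_append, List.getD_cons_zero, List.mem_singleton, forall_eq,
      List.length_singleton, List.foldr_nil]
    simp
    omega
  · rw [List.concat_eq_append]
    generalize hl : l' ++ [z] = l
    have hlen : 1 ≤ l.length := by simp [← hl]
    have getL : ∀ i, i < l.length → ∀ d, (l ++ [x]).getD i d = l.getD i d := by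
      intro i hi d
      exact List.getD_append _ _ _ _ hi
    unfold IsRGS
    rw [getL 0 hlen]
    constructor
    · rintro ⟨h0, h1, h2⟩
      refine ⟨⟨h0, fun y hy => h1 y (by simp [hy]), fun i hi => ?_⟩, h1 x (by simp), ?_⟩
      · have := h2 i (by simp; omega)
        rwa [getL _ hi, List.take_append_of_le_length hi.le] at this
      · have := h2 (l.length - 1) (by simp; omega)
        rw [Nat.sub_add_cancel hlen] at this
        simpa using this
    · rintro ⟨⟨h0, h1, h2⟩, hx, hx'⟩
      refine ⟨h0, ?_, fun i hi => ?_⟩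
      · intro y hy
        rcases List.mem_append.1 hy with hy | hy
        · exact h1 y hy
        · simp at hy; omega
      · rcases Nat.lt_or_ge (i + 1) l.length with h | h
        · rw [getL _ h, List.take_append_of_le_length h.le]
          exact h2 i h
        · have : i + 1 = l.length := by simp at hi; omega
          rw [this]
          simpa using hx'

theorem IsRGS.of_append {l w : List ℕ} (h : IsRGS (l ++ w)) : IsRGS l := by
  induction w using List.reverseRecOn with
  | nil => simpa using h
  | append_singleton w x ih =>
    rw [← List.append_assoc, isRGS_append_singleton] at h
    exact ih h.1

theorem IsRGS.mem {l : List ℕ} (h : IsRGS l) {a : ℕ} (ha : 1 ≤ a) (ha' : a ≤ l.foldr max 0) :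
    a ∈ l := by
  induction l using List.reverseRecOn with
  | nil => simp at ha'; omega
  | append_singleton l x ih =>
    rw [isRGS_append_singleton] at h
    rw [foldr_max_append_singleton] at ha'
    by_cases hx : a ≤ l.foldr max 0
    · simp [ih h.1 hx]
    · have : a = x := by omega
      simp [this]

theorem crossing_append_singleton {l : List ℕ} {x : ℕ} (h : IsRGS l) :
    Crossing (l ++ [x]) ↔ Crossing l ∨ ¬ l.Pairwise fun a b => a = x → x ≤ b := by
  have getL : ∀ i, i < l.length → (l ++ [x]).getD i 0 = l.getD i 0 := fun i hi =>
    List.getD_append _ _ _ _ hi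
  have getR : (l ++ [x]).getD l.length 0 = x := by simp
  have hpw : (¬ l.Pairwise fun a b => a = x → x ≤ b) ↔
      ∃ j k, j < k ∧ k < l.length ∧ l.getD j 0 = x ∧ l.getD k 0 < x := by
    rw [List.pairwise_iff_getElem]
    push Not
    constructor
    · rintro ⟨j, k, hj, hk, hjk, h1, h2⟩
      refine ⟨j, k, hjk, hk, ?_, ?_⟩
      · rw [List.getD_eq_getElem _ _ hj, h1]
      · rwa [List.getD_eq_getElem _ _ hk]
    · rintro ⟨j, k, hjk, hk, h1, h2⟩
      rw [List.getD_eq_getElem _ _ (hjk.trans hk)] at h1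
      rw [List.getD_eq_getElem _ _ hk] at h2
      exact ⟨j, k, hjk.trans hk, hk, hjk, h1, h2⟩
  rw [hpw]
  constructor
  · rintro ⟨i, j, k, m, hij, hjk, hkm, hm, h1, h2, h3⟩
    simp only [List.length_append, List.length_singleton] at hm
    rw [getL i (by omega), getL k (by omega)] at h1
    rw [getL i (by omega), getL j (by omega)] at h3
    rw [getL j (by omega)] at h2
    rcases Nat.lt_or_ge m l.length with hml | hml
    · rw [getL m hml] at h2
      exact Or.inl ⟨i, j, k, m, hij, hjk, hkm, hml, h1, h2, h3⟩
    · obtain rfl : m = l.length := by omega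
      rw [getR] at h2
      exact Or.inr ⟨j, k, hjk, hkm, h2, by omega⟩
  · rintro (⟨i, j, k, m, hij, hjk, hkm, hm, h1, h2, h3⟩ | ⟨j, k, hjk, hk, h1, h2⟩)
    · refine ⟨i, j, k, m, hij, hjk, hkm, by simp; omega, ?_, ?_, ?_⟩
      · rw [getL i (by omega), getL k (by omega), h1]
      · rw [getL j (by omega), getL m (by omega), h2]
      · rwa [getL i (by omega), getL j (by omega)]
    · have hj : j < l.length := hjk.trans hk
      have hpre : IsRGS (l.take j ++ [l[j]]) := by
        have : l = (l.take j ++ [l[j]]) ++ l.drop (j + 1) := by simp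
        rw [this] at h
        exact h.of_append
      rw [isRGS_append_singleton] at hpre
      rw [List.getD_eq_getElem _ _ hj] at h1
      have hmem : l.getD k 0 ∈ l.take j := by
        refine hpre.1.mem ?_ (by omega)
        rw [List.getD_eq_getElem _ _ hk]
        exact h.2.1 _ (List.getElem_mem hk)
      obtain ⟨i, hi, hie⟩ := List.getElem_of_mem hmem
      have hi' : i < j := by simp at hi; omega
      have hie' : l.getD i 0 = l.getD k 0 := by
        rw [← hie, List.getD_eq_getElem _ _ (hi'.trans hj), List.getElem_take]
      refine ⟨i, j, k, l.length, hi', hjk, hk, by simp, ?_, ?_, ?_⟩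
      · rw [getL i (by omega), getL k (by omega), hie']
      · rw [getL j hj, getR, List.getD_eq_getElem _ _ hj, h1]
      · rw [getL i (by omega), getL j hj, hie', List.getD_eq_getElem _ _ hj, h1]
        exact h2

theorem noncrossing_append_singleton (l : List ℕ) (x : ℕ) :
    (IsRGS (l ++ [x]) ∧ ¬ Crossing (l ++ [x])) ↔
      (IsRGS l ∧ ¬ Crossing l) ∧ x ∈ nextLetters l := by
  by_cases h : IsRGS l
  · rw [isRGS_append_singleton, crossing_append_singleton h, nextLetters, mem_filter, mem_Icc]
    tauto
  · simp [isRGS_append_singleton, h]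

theorem nextLetters_append_singleton {l : List ℕ} {x : ℕ} (h : IsRGS l)
    (hx : x ∈ nextLetters l) :
    nextLetters (l ++ [x]) =
      insert (max (l.foldr max 0) x + 1) {y ∈ nextLetters l | y ≤ x} := by
  have hx' := (mem_Icc.1 (mem_filter.1 hx).1)
  ext y
  simp only [nextLetters, foldr_max_append_singleton, mem_filter, mem_Icc, mem_insert,
    List.pairwise_append, List.pairwise_singleton, List.mem_singleton, forall_eq, true_and]
  constructor
  · rintro ⟨⟨h1, h2⟩, h3, h4⟩
    by_cases hy : y = max (l.foldr max 0) x + 1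
    · exact Or.inl hy
    · refine Or.inr ⟨⟨⟨h1, by omega⟩, h3⟩, ?_⟩
      by_cases hyl : y ≤ l.foldr max 0
      · exact h4 y (h.mem h1 hyl) rfl
      · omega
  · rintro (rfl | ⟨⟨⟨h1, h2⟩, h3⟩, h4⟩)
    · refine ⟨⟨by omega, le_rfl⟩, ?_, ?_⟩
      · refine List.Pairwise.imp_of_mem (R := fun _ _ => True) ?_
          (List.pairwise_of_forall fun _ _ => trivial)
        intro a b ha _ _ hab
        have := le_foldr_max ha
        omega
      · intro a ha hab
        have := le_foldr_max ha
        omega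
    · exact ⟨⟨h1, by omega⟩, h3, fun a _ _ => h4⟩

theorem noncrossing_append_iff (w : List ℕ) : ∀ l : List ℕ, IsRGS l → ¬ Crossing l →
    ((IsRGS (l ++ w) ∧ ¬ Crossing (l ++ w)) ↔ Admissible (l.foldr max 0) (nextLetters l) w) := by
  induction w with
  | nil => intro l h h'; simp [Admissible, h, h']
  | cons x w ih =>
    intro l h h'
    have hcons : l ++ x :: w = (l ++ [x]) ++ w := by simp
    rw [Admissible, hcons]
    by_cases hx : x ∈ nextLetters l
    · have hn := (noncrossing_append_singleton l x).2 ⟨⟨h, h'⟩, hx⟩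
      rw [ih _ hn.1 hn.2, nextLetters_append_singleton h hx, foldr_max_append_singleton]
      simp [hx]
    · refine iff_of_false ?_ (fun hh => hx hh.1)
      intro hh
      have hr := hh.1.of_append
      refine hx ((noncrossing_append_singleton l x).1 ⟨hr, ?_⟩).2
      rintro ⟨i, j, k, m, hij, hjk, hkm, hm, h1, h2, h3⟩
      have getL : ∀ i, i < (l ++ [x]).length →
          ((l ++ [x]) ++ w).getD i 0 = (l ++ [x]).getD i 0 :=
        fun i hi => List.getD_append _ _ _ _ hi
      refine hh.2 ⟨i, j, k, m, hij, hjk, hkm, by rw [List.length_append]; omega, ?_⟩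
      rw [getL i (by omega), getL j (by omega), getL k (by omega), getL m hm]
      exact ⟨h1, h2, h3⟩

theorem ncseq_iff_admissible (n : ℕ) (l : List ℕ) :
    NCseq n l ↔ l.length = n ∧ Admissible 0 {1} l := by
  have h := noncrossing_append_iff l [] (by simp [IsRGS]) (by simp [Crossing])
  have h1 : nextLetters [] = {1} := by simp [nextLetters]
  rw [h1] at h
  exact and_congr_right fun _ => h

theorem mem_admissibleWords (n : ℕ) : ∀ (M : ℕ) (S : Finset ℕ) (w : List ℕ),
    w ∈ admissibleWords n M S ↔ w.length = n ∧ Admissible M S w := by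
  induction n with
  | zero =>
    intro M S w
    simp only [admissibleWords, mem_singleton, List.length_eq_zero_iff]
    constructor
    · rintro rfl; simp [Admissible]
    · exact fun h => h.1
  | succ n ih =>
    intro M S w
    cases w with
    | nil => simp [admissibleWords]
    | cons x w => simp [admissibleWords, Admissible, ih, and_left_comm]

theorem sum_card_filter_le (g : ℕ → ℕ) (s : Finset ℕ) :
    ∑ x ∈ s, g #{y ∈ s | y ≤ x} = ∑ j ∈ range #s, g (j + 1) := by
  induction s using Finset.induction_on_max with
  | empty => simp
  | insert a s ha ih =>
    have hn : a ∉ s := fun h => lt_irrefl _ (ha a h)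
    rw [sum_insert hn, card_insert_of_notMem hn, sum_range_succ, ← ih, add_comm]
    congr 1
    · refine sum_congr rfl fun x hx => ?_
      rw [filter_insert, if_neg (by have := ha x hx; omega)]
    · rw [filter_true_of_mem, card_insert_of_notMem hn]
      intro y hy
      rcases mem_insert.1 hy with rfl | hy
      · exact le_rfl
      · exact (ha y hy).le

/-- The number of words of length `n` when `k + 1` next letters are available. -/
def wordCount : ℕ → ℕ → ℕ
  | 0, _ => 1
  | n + 1, k => ∑ j ∈ range (k + 1), wordCount n (j + 1)

theorem card_admissibleWords (n : ℕ) : ∀ (M k : ℕ) (S : Finset ℕ), (∀ y ∈ S, y ≤ M + 1) →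
    #S = k + 1 → #(admissibleWords n M S) = wordCount n k := by
  induction n with
  | zero => intro M k S _ _; rfl
  | succ n ih =>
    intro M k S hS hk
    rw [admissibleWords, card_biUnion]
    · rw [wordCount, ← hk, ← sum_card_filter_le]
      refine sum_congr rfl fun x hx => ?_
      rw [card_image_of_injective _ (List.cons_injective)]
      refine ih _ _ _ ?_ ?_
      · intro y hy
        rcases mem_insert.1 hy with rfl | hy
        · exact le_rfl
        · have := (mem_filter.1 hy).2
          omega
      · refine card_insert_of_notMem fun h => ?_
        have := (mem_filter.1 h).2
        omega
    · intro x _ y _ hxy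
      rw [Function.onFun, disjoint_left]
      intro w hw hw'
      obtain ⟨u, _, rfl⟩ := mem_image.1 hw
      obtain ⟨v, _, hv⟩ := mem_image.1 hw'
      exact hxy (List.cons.inj hv).1.symm

theorem wordCount_succ_add_choose (n : ℕ) : ∀ k,
    wordCount (n + 1) k + (2 * n + 2 + k).choose n = (2 * n + 2 + k).choose (n + 1) := by
  induction n with
  | zero => intro k; simp [wordCount]; omega
  | succ n ih =>
    intro k
    induction k with
    | zero =>
      have h := ih 1
      have e : wordCount (n + 1 + 1) 0 = wordCount (n + 1) 1 := by
        rw [wordCount]; simp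
      rw [e]
      have h1 : (2 * (n + 1) + 2 + 0).choose (n + 1) =
        (2 * n + 2 + 1).choose n + (2 * n + 2 + 1).choose (n + 1) := Nat.choose_succ_succ _ _
      have h2 : (2 * (n + 1) + 2 + 0).choose (n + 1 + 1) =
        (2 * n + 2 + 1).choose (n + 1) + (2 * n + 2 + 1).choose (n + 1 + 1) :=
        Nat.choose_succ_succ _ _
      have h3 : (2 * n + 2 + 1).choose (n + 1 + 1) = (2 * n + 2 + 1).choose (n + 1) :=
        Nat.choose_symm_of_eq_add (by omega)
      omega
    | succ k ihk =>
      have e : wordCount (n + 1 + 1) (k + 1) =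
          wordCount (n + 1 + 1) k + wordCount (n + 1) (k + 1 + 1) := by
        exact sum_range_succ _ _
      have h := ih (k + 1 + 1)
      rw [e]
      have e1 : 2 * n + 2 + (k + 1 + 1) = 2 * (n + 1) + 2 + k := by ring
      rw [e1] at h
      have h1 : (2 * (n + 1) + 2 + (k + 1)).choose (n + 1) =
        (2 * (n + 1) + 2 + k).choose n + (2 * (n + 1) + 2 + k).choose (n + 1) :=
        Nat.choose_succ_succ _ _
      have h2 : (2 * (n + 1) + 2 + (k + 1)).choose (n + 1 + 1) =
        (2 * (n + 1) + 2 + k).choose (n + 1) + (2 * (n + 1) + 2 + k).choose (n + 1 + 1) :=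
        Nat.choose_succ_succ _ _
      omega

theorem wordCount_zero_mul (r : ℕ) : wordCount r 0 * r = (2 * r).choose (r + 1) := by
  cases r with
  | zero => simp
  | succ n =>
    have h := wordCount_succ_add_choose n 0
    have h1 := Nat.choose_succ_right_eq (2 * n + 2) n
    have h2 : (2 * (n + 1)).choose (n + 1 + 1) = (2 * n + 2).choose n :=
      Nat.choose_symm_of_eq_add (by omega)
    have h3 : 2 * n + 2 - n = n + 2 := by omega
    rw [h3] at h1
    rw [h2]
    simp only [add_zero] at h
    rw [← h] at h1
    linarith

theorem admissible_replicate_append (m x : ℕ) (v : List ℕ) : ∀ (u : List ℕ) (M : ℕ)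
    (S : Finset ℕ),
    Admissible M S (u ++ List.replicate (m + 1) x ++ v) ↔ Admissible M S (u ++ x :: v) := by
  intro u
  induction u with
  | nil =>
    intro M S
    simp only [List.nil_append]
    induction m with
    | zero => simp
    | succ m ih =>
      rw [← ih]
      simp only [List.replicate_succ, List.cons_append, Admissible]
      refine and_congr_right fun hx => ?_
      have h1 : max (max M x) x = max M x := by simp
      have h2 : insert (max M x + 1)
          {y ∈ insert (max M x + 1) {y ∈ S | y ≤ x} | y ≤ x} =
          insert (max M x + 1) {y ∈ S | y ≤ x} := by
        ext y
        simp only [mem_insert, mem_filter]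
        tauto
      rw [h1, h2]
      simp [hx]
  | cons a u ih =>
    intro M S
    simp only [List.cons_append, Admissible]
    exact and_congr_right fun _ => ih _ _

theorem occAt_replicate_iff {m : ℕ} (hm : 1 ≤ m) (l : List ℕ) (i : ℕ) :
    occAt (List.replicate m 1) l i ↔
      ∃ u x v, l = u ++ List.replicate m x ++ v ∧ u.length = i := by
  constructor
  · rintro ⟨h1, h2⟩
    simp only [List.length_replicate] at h1 h2
    set t := (l.drop i).take m with ht
    have hlen : m ≤ l.length - i := by
      simp [ht] at h1; omega
    refine ⟨l.take i, t.getD 0 0, (l.drop i).drop m, ?_, by simp; omega⟩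
    have hrep : List.replicate m (t.getD 0 0) = t := by
      symm
      rw [List.eq_replicate_iff]
      refine ⟨h1.symm, fun b hb => ?_⟩
      obtain ⟨j, hj, rfl⟩ := List.getElem_of_mem hb
      have a1 := h2 0 j (by omega) (by omega)
      have a2 := h2 j 0 (by omega) (by omega)
      rw [List.getD_replicate _ (by omega), List.getD_replicate _ (by omega)] at a1 a2
      rw [List.getD_eq_getElem _ _ hj] at a1 a2
      omega
    rw [hrep, ht, List.append_assoc, List.take_append_drop, List.take_append_drop]
  · rintro ⟨u, x, v, rfl, rfl⟩
    have : ((u ++ List.replicate m x ++ v).drop u.length).take m = List.replicate m x := by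
      simp
    rw [occAt, List.length_replicate, this]
    refine ⟨by simp, fun j k hj hk => ?_⟩
    simp only [List.length_replicate] at hj hk
    rw [List.getD_replicate _ hj, List.getD_replicate _ hk, List.getD_replicate _ hj,
      List.getD_replicate _ hk]
    simp

/-- Replace the letter of `p.1` at position `p.2` by `m` copies of itself. -/
def expandLetter (m : ℕ) (p : List ℕ × ℕ) : List ℕ × ℕ :=
  (p.1.take p.2 ++ List.replicate m (p.1.getD p.2 0) ++ p.1.drop (p.2 + 1), p.2)

theorem expandLetter_append (m x : ℕ) (u v : List ℕ) :
    expandLetter m (u ++ x :: v, u.length) = (u ++ List.replicate m x ++ v, u.length) := by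
  simp [expandLetter]

theorem exists_eq_append_cons {l : List ℕ} {i : ℕ} (h : i < l.length) :
    ∃ u x v, l = u ++ x :: v ∧ u.length = i :=
  ⟨l.take i, l[i], l.drop (i + 1), by simp, by simp; omega⟩

theorem setOf_marked_eq_image (r m : ℕ) :
    {p : List ℕ × ℕ | NCseq (r + m) p.1 ∧ occAt (List.replicate (m + 1) 1) p.1 p.2} =
      expandLetter (m + 1) '' (admissibleWords r 0 {1} ×ˢ range r : Finset (List ℕ × ℕ)) := by
  ext ⟨l, i⟩
  simp only [Set.mem_ofPred_eq, ncseq_iff_admissible, occAt_replicate_iff (Nat.le_add_left 1 m),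
    Set.mem_image, mem_coe, mem_product, mem_admissibleWords, mem_range, Prod.exists]
  constructor
  · rintro ⟨⟨h1, h2⟩, u, x, v, rfl, rfl⟩
    rw [admissible_replicate_append] at h2
    simp only [List.length_append, List.length_replicate] at h1
    refine ⟨u ++ x :: v, u.length, ⟨⟨?_, h2⟩, by omega⟩, expandLetter_append _ _ _ _⟩
    simp only [List.length_append, List.length_cons]
    omega
  · rintro ⟨w, j, ⟨⟨h1, h2⟩, h3⟩, h4⟩
    obtain ⟨u, x, v, rfl, rfl⟩ := exists_eq_append_cons (h1 ▸ h3)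
    rw [expandLetter_append, Prod.mk.injEq] at h4
    obtain ⟨rfl, rfl⟩ := h4
    rw [admissible_replicate_append]
    simp only [List.length_append, List.length_cons] at h1
    refine ⟨⟨?_, h2⟩, u, x, v, rfl, rfl⟩
    simp only [List.length_append, List.length_replicate]
    omega

theorem injOn_expandLetter (m : ℕ) :
    Set.InjOn (expandLetter (m + 1)) {p | p.2 < p.1.length} := by
  rintro ⟨l, i⟩ hl ⟨l', i'⟩ hl' h
  obtain ⟨u, x, v, rfl, rfl⟩ := exists_eq_append_cons hl
  obtain ⟨u', x', v', rfl, rfl⟩ := exists_eq_append_cons hl'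
  rw [expandLetter_append, expandLetter_append, Prod.mk.injEq, List.append_assoc,
    List.append_assoc] at h
  obtain ⟨rfl, h'⟩ := List.append_inj h.1 h.2
  obtain ⟨h1, rfl⟩ := List.append_inj h' (by simp)
  simp only [List.replicate_succ, List.cons.injEq] at h1
  rw [h1.1]

/-- For n ≥ m ≥ 1, the total number of occurrences of the subword 1^m over
all members of NC_n equals binom(2r, r+1), where r = n − m + 1. -/
theorem stmt2 (n m : ℕ) (hm : 1 ≤ m) (hmn : m ≤ n) :
    totalOcc n (List.replicate m 1) =
      Nat.choose (2 * (n + 1 - m)) ((n + 1 - m) + 1) := by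
  obtain ⟨m, rfl⟩ : ∃ k, m = k + 1 := ⟨m - 1, by omega⟩
  obtain ⟨r, rfl⟩ : ∃ r, n = r + m := ⟨n - m, by omega⟩
  have hr : r + m + 1 - (m + 1) = r := by omega
  rw [hr, ← wordCount_zero_mul, ← card_admissibleWords r 0 0 {1} (by simp) (by simp)]
  have hinj : Set.InjOn (expandLetter (m + 1))
      (admissibleWords r 0 {1} ×ˢ range r : Finset (List ℕ × ℕ)) := by
    refine (injOn_expandLetter m).mono ?_
    rintro ⟨l, i⟩ hp
    simp only [mem_coe, mem_product, mem_admissibleWords, mem_range] at hp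
    exact hp.2.trans_eq hp.1.1.symm
  calc totalOcc (r + m) (List.replicate (m + 1) 1)
      = Nat.card {p : List ℕ × ℕ | NCseq (r + m) p.1 ∧
          occAt (List.replicate (m + 1) 1) p.1 p.2} := rfl
    _ = #(admissibleWords r 0 {1}) * r := by
      rw [setOf_marked_eq_image, Nat.card_image_of_injOn hinj]
      simp
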